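/- arXiv:1606.04773 — 4 statements merged into one kernel-verified Lean document; each statement's English description precedes it below -/
import Mathlib

section
/- Let T be a unital C*-algebra together with isometries v₁, v₂ ∈ T satisfying v₁v₁* + v₂v₂* ≤ 1 which is universal for these relations (a copy of 𝒯₂), and let F with unital *-homomorphisms j₀, j₁ : T → F be a unital full free product T *_ℂ T. Then there exists a unitary ũ ∈ F such that j₁(v₁) = ũ · j₀(v₁). -/
universe u v w

/-- `T` together with the isometries `v₁, v₂` (satisfying `v₁v₁* + v₂v₂* ≤ 1`) is a copy of the
Cuntz–Toeplitz algebra `𝒯₂`, i.e. it is universal for these relations. -/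
def IsCuntzToeplitz2 (T : Type u) [CStarAlgebra T] [PartialOrder T] [StarOrderedRing T]
    (v₁ v₂ : T) : Prop :=
  star v₁ * v₁ = 1 ∧ star v₂ * v₂ = 1 ∧ v₁ * star v₁ + v₂ * star v₂ ≤ 1 ∧
  ∀ (B : Type v) [CStarAlgebra B] [PartialOrder B] [StarOrderedRing B],
    ∀ w₁ w₂ : B, star w₁ * w₁ = 1 → star w₂ * w₂ = 1 → w₁ * star w₁ + w₂ * star w₂ ≤ 1 →
      ∃! φ : T →⋆ₐ[ℂ] B, φ v₁ = w₁ ∧ φ v₂ = w₂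

/-- `F` together with the unital *-homomorphisms `iA, iB` is a unital full free product
`A *_ℂ B`. -/
def IsFreeProduct (A B F : Type u) [CStarAlgebra A] [CStarAlgebra B] [CStarAlgebra F]
    (iA : A →⋆ₐ[ℂ] F) (iB : B →⋆ₐ[ℂ] F) : Prop :=
  ∀ (C : Type v) [CStarAlgebra C], ∀ (f : A →⋆ₐ[ℂ] C) (g : B →⋆ₐ[ℂ] C),
    ∃! h : F →⋆ₐ[ℂ] C, h.comp iA = f ∧ h.comp iB = g

/-- If `s, a` and `t, b` are two pairs of isometries with orthogonal ranges in a star ring, then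
the defect projections `1 - s s*` and `1 - t t*` are Murray-von Neumann equivalent, hence `t = u s`
for some unitary `u`. -/
theorem exists_unitary_mul_eq_of_orthogonal_isometries {R : Type*} [Ring R] [StarRing R]
    {s a t b : R} (hs : star s * s = 1) (ha : star a * a = 1) (hsa : star s * a = 0)
    (ht : star t * t = 1) (hb : star b * b = 1) (htb : star t * b = 0) :
    ∃ u : unitary R, t = (u : R) * s := by
  have has : star a * s = 0 := by simpa using congrArg star hsa
  have hbt : star b * t = 0 := by simpa using congrArg star htb
  have cancel {x y : R} (h : star x * y = 1) (z : R) : star x * (y * z) = z := by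
    rw [← mul_assoc, h, one_mul]
  have kill {x y : R} (h : star x * y = 0) (z : R) : star x * (y * z) = 0 := by
    rw [← mul_assoc, h, zero_mul]
  refine ⟨⟨t * star s + b * (1 - s * star s - a * star a + a * star t * star a)
    + (1 - t * star t - b * star b + b * s * star b) * star a, ?_⟩, ?_⟩
  · rw [Unitary.mem_iff]
    constructor <;>
    · simp only [star_add, star_sub, star_mul, star_star, mul_add, add_mul, mul_sub,
        sub_mul, mul_one, one_mul, mul_assoc, mul_zero, ha, hsa, hb, htb,
        cancel hs, cancel ha, cancel ht, cancel hb, kill hsa, kill htb, kill has, kill hbt]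
      abel
  · simp [mul_add, add_mul, mul_sub, sub_mul, mul_assoc, hs, has]

/-- Two isometries in a C*-algebra whose range projections have sum at most `1` have orthogonal
ranges. -/
theorem star_mul_eq_zero_of_add_le_one {A : Type*} [CStarAlgebra A] [PartialOrder A]
    [StarOrderedRing A] {s a : A} (hs : star s * s = 1)
    (h : s * star s + a * star a ≤ 1) : star s * a = 0 := by
  have h₁ := star_left_conjugate_le_conjugate h s
  have h₂ : star s * (s * star s + a * star a) * s = 1 + star s * a * star (star s * a) := by
    have h₃ : star s * (s * star s) * s = 1 := by
      rw [← mul_assoc (star s), hs, one_mul, hs]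
    rw [mul_add, add_mul, h₃, star_mul, star_star]
    simp only [mul_assoc]
  rw [h₂, mul_one, hs, add_le_iff_nonpos_right] at h₁
  exact CStarRing.mul_star_self_eq_zero_iff _ |>.mp (le_antisymm h₁ (mul_star_self_nonneg _))

/-- In the unital full free product `𝒯₂ *_ℂ 𝒯₂` there is a unitary `ũ` with
`j₁(v₁) = ũ · j₀(v₁)`. -/
theorem exists_unitary_conjugating_isometries
    (T F : Type u) [CStarAlgebra T] [PartialOrder T] [StarOrderedRing T] [CStarAlgebra F]
    (v₁ v₂ : T) (hT : IsCuntzToeplitz2.{u, v} T v₁ v₂)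
    (j₀ j₁ : T →⋆ₐ[ℂ] F) (hF : IsFreeProduct.{u, w} T T F j₀ j₁) :
    ∃ u : unitary F, j₁ v₁ = (u : F) * j₀ v₁ := by
  obtain ⟨h₁, h₂, hle, -⟩ := hT
  have h₁₂ := star_mul_eq_zero_of_add_le_one h₁ hle
  apply exists_unitary_mul_eq_of_orthogonal_isometries (a := j₀ v₂) (b := j₁ v₂) <;>
    simp only [← map_star, ← map_mul, h₁, h₂, h₁₂, map_one, map_zero]
end

section
/- Let A be a unital C*-algebra containing isometries s₁, s₂ (sᵢ*sᵢ = 1) with s₁s₁* + s₂s₂* = 1. Then the continuous function f : S¹ → A defined on the unit circle S¹ = {z ∈ ℂ : |z| = 1} by f(z) = z·s₁s₁* + s₂s₂* is a unitary element of the C*-algebra C(S¹, A) of continuous A-valued functions on S¹, and f lies in the path component U⁰(C(S¹, A)) of the identity in the unitary group of C(S¹, A). -/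
universe u

section Ring

variable {B : Type*} [Ring B] [StarRing B]

/-- If `q` is a projection commuting with the unitary `z`, then `z * q + (1 - q)` is unitary. -/
lemma IsStarProjection.mul_add_one_sub_mem_unitary {z q : B} (hz : z ∈ unitary B)
    (hc : z * q = q * z) (hq : IsStarProjection q) : z * q + (1 - q) ∈ unitary B := by
  have hqq : q * q = q := hq.isIdempotentElem
  have hqs : star q = q := hq.isSelfAdjoint
  have hqq' (b : B) : q * (q * b) = q * b := by rw [← mul_assoc, hqq]
  have hz₁ : star z * z = 1 := (Unitary.mem_iff.1 hz).1
  have hz₂ : z * star z = 1 := (Unitary.mem_iff.1 hz).2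
  have hz₁' (b : B) : star z * (z * b) = b := by rw [← mul_assoc, hz₁, one_mul]
  have hz₂' (b : B) : z * (star z * b) = b := by rw [← mul_assoc, hz₂, one_mul]
  have hc' : q * star z = star z * q := by simpa [hqs] using congrArg star hc
  have hc₁ (b : B) : q * (z * b) = z * (q * b) := by rw [← mul_assoc, ← hc, mul_assoc]
  have hc₂ (b : B) : q * (star z * b) = star z * (q * b) := by
    rw [← mul_assoc, hc', mul_assoc]
  rw [Unitary.mem_iff]
  constructor <;>
  · simp only [star_add, star_sub, star_mul, star_one, hqs, mul_add, add_mul, mul_sub, sub_mul,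
      mul_one, one_mul, mul_assoc, hqq, hc', hc₁, hc₂, hz₁', hz₂']
    abel

/-- The range projection of an isometry is a projection. -/
lemma isStarProjection_mul_star {x : B} (hx : star x * x = 1) :
    IsStarProjection (x * star x) where
  isIdempotentElem := by
    rw [IsIdempotentElem, mul_assoc, ← mul_assoc (star x), hx, one_mul]
  isSelfAdjoint := by simp [IsSelfAdjoint]

/-- The unitary acting as the central unitary `z` on the range of the isometry `x` and as `1` on
its complement. -/
def rangeUnitary (z : unitary B) (hz : ∀ b, (z : B) * b = b * z) (x : B)
    (hx : star x * x = 1) : unitary B :=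
  ⟨z * (x * star x) + (1 - x * star x),
    (isStarProjection_mul_star hx).mul_add_one_sub_mem_unitary z.2 (hz _)⟩

/-- The self-adjoint unitary exchanging the ranges of the isometries `x` and `y`, if those are
orthogonal. -/
def rangeSwap (x y : B) : B :=
  x * star y + y * star x + (1 - x * star x - y * star y)

lemma isSelfAdjoint_rangeSwap (x y : B) : IsSelfAdjoint (rangeSwap x y) := by
  simp only [IsSelfAdjoint, rangeSwap, star_add, star_sub, star_mul, star_star, star_one]
  abel

lemma rangeSwap_mul_left {x y : B} (hx : star x * x = 1) (hxy : star x * y = 0) :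
    rangeSwap x y * x = y := by
  have hyx : star y * x = 0 := by simpa using congrArg star hxy
  simp [rangeSwap, add_mul, sub_mul, mul_assoc, hx, hyx]

lemma rangeSwap_mul_right {x y : B} (hy : star y * y = 1) (hxy : star x * y = 0) :
    rangeSwap x y * y = x := by
  simp [rangeSwap, add_mul, sub_mul, mul_assoc, hy, hxy]

lemma rangeSwap_mul_self {x y : B} (hx : star x * x = 1) (hy : star y * y = 1)
    (hxy : star x * y = 0) : rangeSwap x y * rangeSwap x y = 1 := by
  have h₁ (b : B) : rangeSwap x y * (x * b) = y * b := by
    rw [← mul_assoc, rangeSwap_mul_left hx hxy]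
  have h₂ (b : B) : rangeSwap x y * (y * b) = x * b := by
    rw [← mul_assoc, rangeSwap_mul_right hy hxy]
  nth_rw 2 [rangeSwap]
  simp only [mul_add, mul_sub, h₁, h₂, mul_one]
  rw [rangeSwap]
  abel

lemma rangeSwap_mem_unitary {x y : B} (hx : star x * x = 1) (hy : star y * y = 1)
    (hxy : star x * y = 0) : rangeSwap x y ∈ unitary B := by
  rw [Unitary.mem_iff, (isSelfAdjoint_rangeSwap x y).star_eq]
  exact ⟨rangeSwap_mul_self hx hy hxy, rangeSwap_mul_self hx hy hxy⟩

lemma rangeSwap_conj_rangeUnitary (z : unitary B) (hz : ∀ b, (z : B) * b = b * z) {x y : B}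
    (hx : star x * x = 1) (hy : star y * y = 1) (hxy : star x * y = 0) :
    (⟨rangeSwap x y, rangeSwap_mem_unitary hx hy hxy⟩ : unitary B) * rangeUnitary z hz x hx *
      (⟨rangeSwap x y, rangeSwap_mem_unitary hx hy hxy⟩ : unitary B)⁻¹ =
      rangeUnitary z hz y hy := by
  have hl := rangeSwap_mul_left hx hxy
  have hr : star x * rangeSwap x y = star y := by
    simpa [(isSelfAdjoint_rangeSwap x y).star_eq] using congrArg star hl
  have hw := rangeSwap_mul_self hx hy hxy
  have hs := (isSelfAdjoint_rangeSwap x y).star_eq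
  have key : rangeSwap x y * (x * star x) * rangeSwap x y = y * star y := by
    rw [← mul_assoc, hl, mul_assoc, hr]
  ext
  change rangeSwap x y * (z * (x * star x) + (1 - x * star x)) * star (rangeSwap x y) =
    z * (y * star y) + (1 - y * star y)
  rw [hs, mul_add, add_mul, ← mul_assoc _ (z : B), ← hz, mul_assoc (z : B), mul_assoc (z : B), key,
    mul_sub, sub_mul, key, mul_one, hw]

end Ring

section Topology

variable {B : Type*} [Ring B] [StarRing B] [Algebra ℂ B] [StarModule ℂ B] [TopologicalSpace B]
  [IsTopologicalRing B] [ContinuousSMul ℂ B]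

/-- A self-adjoint unitary is joined to `1` by a path of unitaries. -/
lemma joined_one_of_isSelfAdjoint (w : unitary B) (hw : IsSelfAdjoint (w : B)) :
    Joined 1 w := by
  have hww : (w : B) * w = 1 := by
    simpa [hw.star_eq] using (Unitary.mem_iff.1 w.2).1
  set e : B := (2⁻¹ : ℂ) • (1 - (w : B)) with he
  have hproj : IsStarProjection e := by
    constructor
    · rw [IsIdempotentElem, he, smul_mul_smul_comm,
        show (1 - (w : B)) * (1 - w) = (2 : ℂ) • (1 - (w : B)) by
          simp only [mul_sub, sub_mul, hww, two_smul, mul_one, one_mul]; abel, smul_smul]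
      norm_num
    · simp [IsSelfAdjoint, he, hw.star_eq]
  let g : Circle → unitary B := fun c ↦ ⟨algebraMap ℂ B c * e + (1 - e),
    hproj.mul_add_one_sub_mem_unitary (by
      simp [Unitary.mem_iff, ← algebraMap_star_comm, ← map_mul, ← Complex.normSq_eq_conj_mul_self,
        Complex.mul_conj]) (Algebra.commutes _ _)⟩
  have hg : Continuous g := by
    refine Continuous.subtype_mk ?_ _
    have := continuous_algebraMap ℂ B
    fun_prop
  have h1 : g 1 = 1 := by ext; simp [g]
  have h2 : g (Circle.exp Real.pi) = w := by
    ext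
    have : (2 : ℂ) • e = 1 - (w : B) := by rw [he, smul_smul]; norm_num
    have h' : (w : B) = 1 - e - e := by
      rw [two_smul] at this
      rw [sub_sub, this]; abel
    simp only [g, Circle.coe_exp, Complex.exp_pi_mul_I, map_neg, map_one]
    rw [h']
    simp
    abel
  rw [← h1, ← h2]
  exact (PathConnectedSpace.joined _ _).map hg

variable [ContinuousStar B]

/-- The unitaries attached to orthogonal isometries lie in the same path component. -/
lemma joined_rangeUnitary (z : unitary B) (hz : ∀ b, (z : B) * b = b * z) {x y : B}
    (hx : star x * x = 1) (hy : star y * y = 1) (hxy : star x * y = 0) :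
    Joined (rangeUnitary z hz x hx) (rangeUnitary z hz y hy) := by
  have hw := joined_one_of_isSelfAdjoint ⟨_, rangeSwap_mem_unitary hx hy hxy⟩
    (isSelfAdjoint_rangeSwap x y)
  have := (hw.mul (.refl (rangeUnitary z hz x hx))).mul hw.inv
  rwa [rangeSwap_conj_rangeUnitary z hz hx hy hxy, one_mul, inv_one, mul_one] at this

/-- In the presence of a unital copy of the Cuntz algebra `𝒪₂`, the unitary attached to the first
generating isometry is joined to `1`. -/
lemma joined_one_rangeUnitary (z : unitary B) (hz : ∀ b, (z : B) * b = b * z) {s₁ s₂ : B}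
    (h₁ : star s₁ * s₁ = 1) (h₂ : star s₂ * s₂ = 1)
    (hsum : s₁ * star s₁ + s₂ * star s₂ = 1) :
    Joined 1 (rangeUnitary z hz s₁ h₁) := by
  have h₁' (b : B) : star s₁ * (s₁ * b) = b := by rw [← mul_assoc, h₁, one_mul]
  have h₁₂ : star s₁ * s₂ = 0 := by
    have := congrArg (fun b ↦ star s₁ * b * s₂) hsum
    simpa [mul_add, add_mul, mul_assoc, h₁', h₂] using this
  have h₁₁ : star (s₁ * s₁) * (s₁ * s₁) = 1 := by simp [mul_assoc, h₁', h₁]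
  have h₁₂' : star (s₁ * s₂) * (s₁ * s₂) = 1 := by simp [mul_assoc, h₁', h₂]
  have hp := joined_rangeUnitary z hz h₁ h₂ h₁₂
  have hq := joined_rangeUnitary z hz h₁₁ h₂ (by simp [mul_assoc, h₁₂])
  have hq' := joined_rangeUnitary z hz h₁₂' h₂ (by simp [mul_assoc, h₁₂])
  have hprod : rangeUnitary z hz (s₁ * s₁) h₁₁ * rangeUnitary z hz (s₁ * s₂) h₁₂' =
      rangeUnitary z hz s₁ h₁ := by
    set q : B := s₁ * s₁ * star (s₁ * s₁) with hqdef
    set q' : B := s₁ * s₂ * star (s₁ * s₂) with hqdef'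
    have hqq' : q * q' = 0 := by
      have h₁₂₂ (b : B) : star s₁ * (s₂ * b) = 0 := by rw [← mul_assoc, h₁₂, zero_mul]
      simp [hqdef, hqdef', mul_assoc, h₁', h₁₂₂]
    have hadd : s₁ * star s₁ = q + q' := by
      calc s₁ * star s₁ = s₁ * (s₁ * star s₁ + s₂ * star s₂) * star s₁ := by
            rw [hsum, mul_one]
        _ = q + q' := by simp [hqdef, hqdef', mul_add, add_mul, mul_assoc]
    ext
    change (z * q + (1 - q)) * (z * q' + (1 - q')) = z * (s₁ * star s₁) + (1 - s₁ * star s₁)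
    have hzq : q * (z * q') = 0 := by rw [← mul_assoc, ← hz, mul_assoc, hqq', mul_zero]
    rw [hadd]
    simp only [mul_add, add_mul, mul_sub, sub_mul, mul_one, one_mul, mul_assoc, hzq, hqq', mul_zero]
    abel
  have hR := ((hq.mul hq').symm.trans (hprod ▸ hp)).mul
    (.refl (rangeUnitary z hz s₂ h₂)⁻¹)
  rw [mul_inv_cancel, mul_inv_cancel_right] at hR
  exact hR.symm.trans hp.symm

end Topology

/-- If `s₁, s₂` are isometries in a unital C*-algebra `A` with `s₁s₁* + s₂s₂* = 1`, then
`f(z) = z·s₁s₁* + s₂s₂*` is a unitary in `C(S¹, A)` lying in the path component of the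
identity of the unitary group of `C(S¹, A)`. -/
theorem circle_unitary_in_pathComponent_one
    (A : Type u) [CStarAlgebra A] (s₁ s₂ : A)
    (h₁ : star s₁ * s₁ = 1) (h₂ : star s₂ * s₂ = 1)
    (hsum : s₁ * star s₁ + s₂ * star s₂ = 1) :
    ∃ hf : (⟨fun z : Circle => (z : ℂ) • (s₁ * star s₁) + s₂ * star s₂,
        by continuity⟩ : C(Circle, A)) ∈ unitary C(Circle, A),
      (⟨_, hf⟩ : unitary C(Circle, A)) ∈ pathComponent 1 := by
  let z : unitary C(Circle, A) := ⟨⟨fun c ↦ algebraMap ℂ A c, by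
      have := continuous_algebraMap ℂ A
      fun_prop⟩, by
    rw [Unitary.mem_iff]
    constructor <;> ext c <;>
      simp [← algebraMap_star_comm, ← map_mul, ← Complex.normSq_eq_conj_mul_self, Complex.mul_conj]⟩
  have hz (b : C(Circle, A)) : (z : C(Circle, A)) * b = b * z := by
    ext c
    exact Algebra.commutes _ _
  have hs₁ : star (ContinuousMap.const Circle s₁) * ContinuousMap.const Circle s₁ = 1 := by
    ext; simpa using h₁
  have hs₂ : star (ContinuousMap.const Circle s₂) * ContinuousMap.const Circle s₂ = 1 := by
    ext; simpa using h₂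
  have key := joined_one_rangeUnitary z hz hs₁ hs₂ (by ext; simpa using hsum)
  have heq : (⟨fun z : Circle => (z : ℂ) • (s₁ * star s₁) + s₂ * star s₂,
      by continuity⟩ : C(Circle, A)) = rangeUnitary z hz _ hs₁ := by
    ext c
    simp [rangeUnitary, z, Algebra.smul_def, ← hsum]
  refine ⟨heq ▸ Subtype.prop _, ?_⟩
  rw [mem_pathComponent_iff]
  convert key using 1
  exact Subtype.ext heq
end

section
/- Let T be a unital C*-algebra together with isometries v₁, v₂ satisfying v₁v₁* + v₂v₂* ≤ 1 which is universal for these relations (a copy of 𝒯₂), and let F be a unital full free product T *_ℂ T. Then F does not have real rank zero: the set of invertible self-adjoint elements of F is not dense in the set of self-adjoint elements of F. -/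
universe u v w

namespace ULift
variable {A : Type u}

instance [Star A] : Star (ULift.{w} A) := ⟨fun x => ⟨star x.down⟩⟩

instance [NonUnitalNonAssocSemiring A] [StarRing A] : StarRing (ULift.{w} A) where
  star_involutive x := ULift.down_injective (star_star x.down)
  star_mul x y := ULift.down_injective (star_mul x.down y.down)
  star_add x y := ULift.down_injective (star_add x.down y.down)

noncomputable instance [CStarAlgebra A] : CStarAlgebra (ULift.{w} A) where
  norm_mul_self_le x := CStarRing.norm_mul_self_le x.down
  star_smul c x := ULift.down_injective (star_smul c x.down)

/-- `ULift.down` as a star algebra equivalence. -/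
def starAlgEquivDown (A : Type u) [CStarAlgebra A] : ULift.{w} A ≃⋆ₐ[ℂ] A where
  __ := ULift.ringEquiv
  map_star' _ := rfl
  map_smul' _ _ := rfl

end ULift

open scoped InnerProductSpace in
/-- There are two isometries with orthogonal ranges in a nontrivial C⋆-algebra. -/
theorem exists_isometries_orthogonal_ranges :
    ∃ (B : Type) (_ : CStarAlgebra B) (_ : Nontrivial B) (s₁ s₂ : B),
      star s₁ * s₁ = 1 ∧ star s₂ * s₂ = 1 ∧ star s₁ * s₂ = 0 := by
  let b : HilbertBasis ℕ ℂ (lp (fun _ : ℕ => ℂ) 2) := .ofRepr (.refl ℂ _)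
  have hb := b.orthonormal
  have h₁ : Orthonormal ℂ (fun n => b (2 * n)) :=
    hb.comp _ (mul_right_injective₀ two_ne_zero)
  have h₂ : Orthonormal ℂ (fun n => b (2 * n + 1)) :=
    hb.comp _ ((add_left_injective 1).comp (mul_right_injective₀ two_ne_zero))
  have isom (L : lp (fun _ : ℕ => ℂ) 2 →ₗᵢ[ℂ] lp (fun _ : ℕ => ℂ) 2) :
      star L.toContinuousLinearMap * L.toContinuousLinearMap = 1 :=
    (ContinuousLinearMap.norm_map_iff_adjoint_comp_self _).1 L.norm_map
  have : Nontrivial (lp (fun _ : ℕ => ℂ) 2) := ⟨b 0, 0, hb.ne_zero 0⟩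
  refine ⟨lp (fun _ : ℕ => ℂ) 2 →L[ℂ] lp (fun _ : ℕ => ℂ) 2, inferInstance, inferInstance,
    h₁.orthogonalFamily.linearIsometry.toContinuousLinearMap,
    h₂.orthogonalFamily.linearIsometry.toContinuousLinearMap, isom _, isom _, ?_⟩
  ext1 f
  refine ext_inner_left ℂ fun g => ?_
  have key (n : ℕ) : ⟪h₁.orthogonalFamily.linearIsometry g, b (2 * n + 1)⟫_ℂ = 0 := by
    refine ((h₁.orthogonalFamily.hasSum_linearIsometry g).mapL
      ((innerSL ℂ).flip (b (2 * n + 1)))).unique ?_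
    convert hasSum_zero with i
    have : ⟪b (2 * i), b (2 * n + 1)⟫_ℂ = 0 := hb.2 (by omega)
    simp [this]
  simp only [mul_apply_eq_comp, ContinuousLinearMap.star_eq_adjoint,
    ContinuousLinearMap.adjoint_inner_right, zero_apply, inner_zero_right]
  refine ((h₂.orthogonalFamily.hasSum_linearIsometry f).mapL
      (innerSL ℂ (h₁.orthogonalFamily.linearIsometry g))).unique ?_
  convert hasSum_zero with i
  simp [key]

/-- Isometries with orthogonal ranges satisfy the Cuntz–Toeplitz relation. -/
theorem mul_star_add_mul_star_le_one {B : Type*} [CStarAlgebra B] [PartialOrder B]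
    [StarOrderedRing B] {a b : B} (ha : star a * a = 1) (hb : star b * b = 1)
    (hab : star a * b = 0) : a * star a + b * star b ≤ 1 := by
  have hba : star b * a = 0 := by simpa using congrArg star hab
  have h : 1 - (a * star a + b * star b)
      = star (1 - (a * star a + b * star b)) * (1 - (a * star a + b * star b)) := by
    have e₁ : a * star a * (a * star a) = a * star a := by
      rw [mul_assoc, ← mul_assoc (star a), ha, one_mul]
    have e₂ : b * star b * (b * star b) = b * star b := by
      rw [mul_assoc, ← mul_assoc (star b), hb, one_mul]
    have e₃ : a * star a * (b * star b) = 0 := by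
      rw [mul_assoc, ← mul_assoc (star a), hab, zero_mul, mul_zero]
    have e₄ : b * star b * (a * star a) = 0 := by
      rw [mul_assoc, ← mul_assoc (star b), hba, zero_mul, mul_zero]
    simp only [star_sub, star_one, star_add, star_mul, star_star, mul_sub, sub_mul, mul_add,
      add_mul, one_mul, mul_one, e₁, e₂, e₃, e₄]
    abel
  rw [← sub_nonneg, h]
  exact star_mul_self_nonneg _

theorem abs_sub_le_norm_sub_of_mem_spectrum {B : Type*} [CStarAlgebra B] {a : B} {μ : ℝ} (r : ℝ)
    (hμ : μ ∈ spectrum ℝ a) : |μ - r| ≤ ‖a - algebraMap ℝ B r‖ := by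
  have : Nontrivial B := by
    by_contra h
    rw [not_nontrivial_iff_subsingleton] at h
    simp [spectrum.of_subsingleton] at hμ
  refine spectrum.norm_le_norm_of_mem (𝕜 := ℝ) ?_
  rw [← spectrum.sub_singleton_eq]
  exact Set.sub_mem_sub hμ rfl

theorem norm_eq_zero_or_one_of_isSelfAdjoint_of_mul_self {B : Type*} [CStarAlgebra B] {p : B}
    (hp : IsSelfAdjoint p) (h : p * p = p) : ‖p‖ = 0 ∨ ‖p‖ = 1 := by
  have := hp.norm_mul_self
  rw [h] at this
  rcases eq_or_ne ‖p‖ 0 with h0 | h0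
  · exact .inl h0
  · right
    field_simp at this
    nlinarith [this, sq_nonneg ‖p‖]

/-- A self-adjoint element which a pointwise continuous path of representations maps first near
`-1` and finally near `1` is not invertible. -/
theorem not_isUnit_of_norm_add_one_lt_one {A B : Type*} [CStarAlgebra A] [CStarAlgebra B]
    [Nontrivial B] (ψ : unitInterval → A →⋆ₐ[ℂ] B) (hψ : ∀ a, Continuous fun t => ψ t a) {y : A}
    (hy : IsSelfAdjoint y) (h₀ : ‖ψ 0 y + 1‖ < 1) (h₁ : ‖ψ 1 y - 1‖ < 1) : ¬ IsUnit y := by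
  intro hu
  let f : ℝ → ℝ := fun x => (1 + x / |x|) / 2
  have hspec : ∀ x ∈ spectrum ℝ y, x ≠ 0 := fun x hx h =>
    spectrum.zero_notMem ℝ hu (h ▸ hx)
  have hf : ContinuousOn f (spectrum ℝ y) :=
    (continuousOn_const.add (continuousOn_id.div continuous_abs.continuousOn
      fun x hx => abs_ne_zero.2 (hspec x hx))).div_const 2
  have heval (t : unitInterval) : ψ t (cfc f y) = cfc f (ψ t y) :=
    StarAlgHomClass.map_cfc (R := ℝ) (S := ℂ) (ψ t) f y hf
      (AddMonoidHomClass.continuous_of_bound (ψ t) 1 fun a => by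
        simpa using NonUnitalStarAlgHom.norm_apply_le (ψ t) a) hy (hy.map (ψ t))
  have hidem : cfc f y * cfc f y = cfc f y := by
    rw [← cfc_mul f f y hf hf]
    refine cfc_congr fun x hx => ?_
    rcases lt_or_gt_of_ne (hspec x hx) with h | h
    · simp [f, abs_of_neg h, h.ne]
    · simp [f, abs_of_pos h, h.ne']
  have hsa : IsSelfAdjoint (cfc f y) := cfc_predicate f y
  have hnorm (t : unitInterval) : ‖ψ t (cfc f y)‖ = 0 ∨ ‖ψ t (cfc f y)‖ = 1 :=
    norm_eq_zero_or_one_of_isSelfAdjoint_of_mul_self (hsa.map (ψ t)) (by rw [← map_mul, hidem])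
  have hz : ‖ψ 0 (cfc f y)‖ = 0 := by
    rw [heval, cfc_congr (g := fun _ => 0), cfc_const_zero, norm_zero]
    intro x hx
    have := (abs_sub_le_norm_sub_of_mem_spectrum (-1) hx).trans_lt (by simpa using h₀)
    have h : x < 0 := by linarith [(abs_lt.1 this).2]
    simp [f, abs_of_neg h, h.ne]
  have ho : ‖ψ 1 (cfc f y)‖ = 1 := by
    rw [heval, cfc_congr (g := fun _ => 1), cfc_const_one ℝ (ψ 1 y) (hy.map (ψ 1)), norm_one]
    intro x hx
    have := (abs_sub_le_norm_sub_of_mem_spectrum 1 hx).trans_lt (by simpa using h₁)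
    have h : 0 < x := by linarith [(abs_lt.1 this).1]
    simp [f, abs_of_pos h, h.ne']
  obtain ⟨t, ht⟩ := mem_range_of_exists_le_of_exists_ge (c := (1 / 2 : ℝ)) (hψ (cfc f y)).norm
    ⟨0, by rw [hz]; norm_num⟩ ⟨1, by rw [ho]; norm_num⟩
  rcases hnorm t with h | h <;> norm_num [h] at ht

/-- The universal property of `𝒯₂` yields homomorphisms into algebras of any universe. -/
theorem IsCuntzToeplitz2.exists_hom {T : Type u} [CStarAlgebra T] [PartialOrder T]
    [StarOrderedRing T] {v₁ v₂ : T} (hT : IsCuntzToeplitz2.{u, v} T v₁ v₂)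
    {B : Type} [CStarAlgebra B] {w₁ w₂ : B} (h₁ : star w₁ * w₁ = 1) (h₂ : star w₂ * w₂ = 1)
    (h : star w₁ * w₂ = 0) : ∃ φ : T →⋆ₐ[ℂ] B, φ v₁ = w₁ := by
  let e := ULift.starAlgEquivDown.{0, v} B
  let _ := CStarAlgebra.spectralOrder (ULift.{v} B)
  have := CStarAlgebra.spectralOrderedRing (ULift.{v} B)
  have h₁' : star (e.symm w₁) * e.symm w₁ = 1 := by rw [← map_star, ← map_mul, h₁, map_one]
  have h₂' : star (e.symm w₂) * e.symm w₂ = 1 := by rw [← map_star, ← map_mul, h₂, map_one]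
  have h' : star (e.symm w₁) * e.symm w₂ = 0 := by rw [← map_star, ← map_mul, h, map_zero]
  obtain ⟨φ, ⟨hφ, -⟩, -⟩ := hT.2.2.2 (ULift.{v} B) (e.symm w₁) (e.symm w₂) h₁' h₂'
    (mul_star_add_mul_star_le_one h₁' h₂' h')
  exact ⟨(e : ULift.{v} B →⋆ₐ[ℂ] B).comp φ, by simp [hφ]⟩

/-- The universal property of the free product yields homomorphisms into algebras of any
universe. -/
theorem IsFreeProduct.exists_hom {A B F : Type u} [CStarAlgebra A] [CStarAlgebra B]
    [CStarAlgebra F] {iA : A →⋆ₐ[ℂ] F} {iB : B →⋆ₐ[ℂ] F} (hF : IsFreeProduct.{u, w} A B F iA iB)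
    {C : Type} [CStarAlgebra C] (f : A →⋆ₐ[ℂ] C) (g : B →⋆ₐ[ℂ] C) :
    ∃ h : F →⋆ₐ[ℂ] C, (∀ a, h (iA a) = f a) ∧ ∀ b, h (iB b) = g b := by
  let e := ULift.starAlgEquivDown.{0, w} C
  obtain ⟨h, ⟨hA, hB⟩, -⟩ := hF (ULift.{w} C) ((e.symm : C →⋆ₐ[ℂ] ULift.{w} C).comp f)
    ((e.symm : C →⋆ₐ[ℂ] ULift.{w} C).comp g)
  refine ⟨(e : ULift.{w} C →⋆ₐ[ℂ] C).comp h, fun a => ?_, fun b => ?_⟩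
  · simpa using congrArg e (DFunLike.congr_fun hA a)
  · simpa using congrArg e (DFunLike.congr_fun hB b)

theorem star_rotation_mul_rotation {B : Type*} [CStarAlgebra B] {s₁ s₂ : B}
    (h₁ : star s₁ * s₁ = 1) (h₂ : star s₂ * s₂ = 1) (h : star s₁ * s₂ = 0) (a b c d : ℝ) :
    star (a • s₁ + b • s₂) * (c • s₁ + d • s₂) = (a * c + b * d) • (1 : B) := by
  have h' : star s₂ * s₁ = 0 := by simpa using congrArg star h
  simp only [star_add, star_smul, star_trivial, add_mul, mul_add, smul_mul_smul_comm, h₁, h₂, h,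
    h', smul_zero, add_zero, zero_add, add_smul]

/-- A homomorphism of `𝒯₂` rotating a pair of isometries with orthogonal ranges along a path. -/
theorem IsCuntzToeplitz2.exists_hom_rotation {T : Type u} [CStarAlgebra T] [PartialOrder T]
    [StarOrderedRing T] {v₁ v₂ : T} (hT : IsCuntzToeplitz2.{u, v} T v₁ v₂)
    {B : Type} [CStarAlgebra B] {s₁ s₂ : B} (h₁ : star s₁ * s₁ = 1) (h₂ : star s₂ * s₂ = 1)
    (h : star s₁ * s₂ = 0) {c d : unitInterval → ℝ} (hc : Continuous c) (hd : Continuous d)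
    (hcd : ∀ t, c t * c t + d t * d t = 1) :
    ∃ φ : T →⋆ₐ[ℂ] C(unitInterval, B), ∀ t, φ v₁ t = c t • s₁ + d t • s₂ := by
  let w₁ : C(unitInterval, B) := ⟨fun t => c t • s₁ + d t • s₂, by fun_prop⟩
  let w₂ : C(unitInterval, B) := ⟨fun t => (-d t) • s₁ + c t • s₂, by fun_prop⟩
  have e₁ : star w₁ * w₁ = 1 := by
    ext1 t
    refine (star_rotation_mul_rotation h₁ h₂ h _ _ _ _).trans ?_
    rw [hcd, one_smul, ContinuousMap.one_apply]
  have e₂ : star w₂ * w₂ = 1 := by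
    ext1 t
    refine (star_rotation_mul_rotation h₁ h₂ h _ _ _ _).trans ?_
    rw [neg_mul_neg, add_comm, hcd, one_smul, ContinuousMap.one_apply]
  have e₃ : star w₁ * w₂ = 0 := by
    ext1 t
    refine (star_rotation_mul_rotation h₁ h₂ h _ _ _ _).trans ?_
    rw [mul_neg, mul_comm (d t), neg_add_cancel, zero_smul, ContinuousMap.zero_apply]
  obtain ⟨φ, hφ⟩ := hT.exists_hom e₁ e₂ e₃
  exact ⟨φ, fun t => DFunLike.congr_fun hφ t⟩

/-- Evaluation of continuous functions with values in a C⋆-algebra as a star homomorphism. -/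
def evalStarAlgHomAt {X : Type*} [TopologicalSpace X] [CompactSpace X] (B : Type*)
    [CStarAlgebra B] (t : X) : C(X, B) →⋆ₐ[ℂ] B where
  toFun a := a t
  map_one' := rfl
  map_mul' _ _ := rfl
  map_zero' := rfl
  map_add' _ _ := rfl
  commutes' _ := rfl
  map_star' _ := rfl

/-- The unital full free product `𝒯₂ *_ℂ 𝒯₂` does not have real rank zero: the invertible
self-adjoint elements are not dense in the self-adjoint elements. -/
theorem freeProduct_T2_T2_not_realRankZero
    (T F : Type u) [CStarAlgebra T] [PartialOrder T] [StarOrderedRing T] [CStarAlgebra F]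
    (v₁ v₂ : T) (hT : IsCuntzToeplitz2.{u, v} T v₁ v₂)
    (j₀ j₁ : T →⋆ₐ[ℂ] F) (hF : IsFreeProduct.{u, w} T T F j₀ j₁) :
    ¬ ∀ x : F, IsSelfAdjoint x → x ∈ closure {y : F | IsSelfAdjoint y ∧ IsUnit y} := by
  intro hdense
  obtain ⟨B, _, _, s₁, s₂, h₁, h₂, h⟩ := exists_isometries_orthogonal_ranges
  let d (t : unitInterval) : ℝ := √(1 - t ^ 2)
  obtain ⟨f, hf⟩ := hT.exists_hom_rotation h₁ h₂ h (c := fun _ => 1) (d := fun _ => 0)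
    continuous_const continuous_const (by simp)
  obtain ⟨g, hg⟩ := hT.exists_hom_rotation h₁ h₂ h (c := fun t => t) (d := d)
    (by fun_prop) (by fun_prop) fun t => by
      have : (0 : ℝ) ≤ 1 - t ^ 2 := by nlinarith [t.2.1, t.2.2]
      rw [Real.mul_self_sqrt this]
      ring
  obtain ⟨k, hkf, hkg⟩ := hF.exists_hom f g
  let ψ (t : unitInterval) : F →⋆ₐ[ℂ] B := (evalStarAlgHomAt B t).comp k
  let z : F := star (j₀ v₁) * j₁ v₁
  have hz (t : unitInterval) : ψ t z = (t : ℝ) • (1 : B) := by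
    have e : ψ t z = star (f v₁ t) * g v₁ t := by
      rw [← hkf, ← hkg]
      simp only [z, map_mul, map_star]
      rfl
    rw [e, hf, hg, star_rotation_mul_rotation h₁ h₂ h]
    simp
  let x : F := z + star z - 1
  have hx : IsSelfAdjoint x := (IsSelfAdjoint.add_star_self z).sub (.one F)
  have hψx (t : unitInterval) : ψ t x = (2 * (t : ℝ) - 1) • (1 : B) := by
    simp only [x, map_sub, map_add, map_star, map_one, hz, star_smul, star_one, star_trivial]
    module
  obtain ⟨y, ⟨hy, hyu⟩, hxy⟩ := Metric.mem_closure_iff.1 (hdense x hx) 1 one_pos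
  have hclose (t : unitInterval) : ‖ψ t y - ψ t x‖ < 1 := by
    rw [← map_sub]
    refine (NonUnitalStarAlgHom.norm_apply_le (ψ t) _).trans_lt ?_
    rwa [← dist_eq_norm, dist_comm]
  refine not_isUnit_of_norm_add_one_lt_one ψ (fun a => (k a).continuous) hy ?_ ?_ hyu
  · simpa [hψx] using hclose 0
  · have h2 : (2 * ((1 : unitInterval) : ℝ) - 1) = 1 := by norm_num
    simpa only [hψx, h2, one_smul] using hclose 1
end

section
/- Let T be a unital C*-algebra together with isometries v₁, v₂ satisfying v₁v₁* + v₂v₂* ≤ 1 which is universal for these relations (a copy of 𝒯₂), let F with unital *-homomorphisms j₀, j₁ : T → F be a unital full free product T *_ℂ T, and let D := { f ∈ C([0,1], F) : f(0) ∈ j₀(T) and f(1) ∈ j₁(T) }. Then for every t ∈ [0,1], the image { f(t) : f ∈ D } of the evaluation map at t is a properly infinite unital C*-subalgebra of F; that is, every fibre of the C([0,1])-algebra D is properly infinite. -/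
universe u v w

open scoped CStarAlgebra in
theorem StarAlgHom.exists_isSelfAdjoint_norm_le_of_map_eq {A B : Type*} [CStarAlgebra A]
    [CStarAlgebra B] (φ : A →⋆ₐ[ℂ] B) (a : A) (ha : IsSelfAdjoint a) :
    ∃ a' : A, φ a' = φ a ∧ ‖a'‖ ≤ ‖φ a‖ := by
  rcases subsingleton_or_nontrivial B with _ | _
  · exact ⟨0, Subsingleton.elim _ _, by simp⟩
  let r : ℝ := ‖φ a‖
  have hr : 0 ≤ r := norm_nonneg _
  let f : ℝ → ℝ := fun x => max (-r) (min r x)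
  have hf : Continuous f := by fun_prop
  have hφ : Continuous φ := map_continuous φ
  refine ⟨cfc f a, ?_, ?_⟩
  · rw [StarAlgHomClass.map_cfc φ f a hf.continuousOn hφ ha (ha.map φ)]
    conv_rhs => rw [← cfc_id ℝ (φ a) (ha.map φ)]
    refine cfc_congr fun x hx => ?_
    obtain ⟨h1, h2⟩ := abs_le.mp (spectrum.norm_le_norm_of_mem hx)
    simp only [f, id]
    rw [min_eq_right h2, max_eq_right h1]
  · refine norm_cfc_le hr fun x _ => abs_le.mpr ⟨le_max_left _ _, ?_⟩
    exact max_le (by linarith) (min_le_left _ _)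

theorem StarAlgHom.exists_norm_le_two_mul_of_map_eq {A B : Type*} [CStarAlgebra A]
    [CStarAlgebra B] (φ : A →⋆ₐ[ℂ] B) (a : A) :
    ∃ a' : A, φ a' = φ a ∧ ‖a'‖ ≤ 2 * ‖φ a‖ := by
  obtain ⟨x, hx, hxn⟩ := φ.exists_isSelfAdjoint_norm_le_of_map_eq (realPart a : A) (realPart a).2
  obtain ⟨y, hy, hyn⟩ :=
    φ.exists_isSelfAdjoint_norm_le_of_map_eq (imaginaryPart a : A) (imaginaryPart a).2
  have hre : φ (realPart a : A) = (realPart (φ a) : B) := map_realPart φ a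
  have him : φ (imaginaryPart a : A) = (imaginaryPart (φ a) : B) := map_imaginaryPart φ a
  refine ⟨x + Complex.I • y, ?_, ?_⟩
  · rw [map_add, map_smul, hx, hy, hre, him, realPart_add_I_smul_imaginaryPart]
  · have h1 : ‖x‖ ≤ ‖φ a‖ := hxn.trans (hre ▸ realPart.norm_le (φ a))
    have h2 : ‖y‖ ≤ ‖φ a‖ := hyn.trans (him ▸ imaginaryPart.norm_le (φ a))
    calc ‖x + Complex.I • y‖ ≤ ‖x‖ + ‖Complex.I • y‖ := norm_add_le _ _
      _ = ‖x‖ + ‖y‖ := by rw [norm_smul, Complex.norm_I, one_mul]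
      _ ≤ 2 * ‖φ a‖ := by linarith

theorem StarAlgHom.isClosed_range_of_cstarAlgebra {A B : Type*} [CStarAlgebra A] [CStarAlgebra B]
    (φ : A →⋆ₐ[ℂ] B) : IsClosed (Set.range φ) := by
  let f : NormedAddGroupHom A B := AddMonoidHom.mkNormedAddGroupHom
    φ.toAlgHom.toRingHom.toAddMonoidHom 1
    fun x => by simpa using NonUnitalStarAlgHom.norm_apply_le φ x
  have h : f.SurjectiveOnWith f.range 2 := by
    rintro _ ⟨a, rfl⟩
    exact φ.exists_norm_le_two_mul_of_map_eq a
  have hcl := controlled_closure_of_complete two_pos one_pos h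
  refine isClosed_of_closure_subset fun b hb => ?_
  obtain ⟨a, ha, -⟩ := hcl b hb
  exact ⟨a, ha⟩

/-- With `F = 𝒯₂ *_ℂ 𝒯₂` and
`D = { f ∈ C([0,1], F) : f(0) ∈ j₀(𝒯₂), f(1) ∈ j₁(𝒯₂) }`, for every `t ∈ [0,1]` the image of
the evaluation map `D → F` at `t` is a properly infinite unital C*-subalgebra of `F`. -/
theorem cone_algebra_fibres_properlyInfinite
    (T F : Type u) [CStarAlgebra T] [PartialOrder T] [StarOrderedRing T]
    [CStarAlgebra F] [PartialOrder F] [StarOrderedRing F]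
    (v₁ v₂ : T) (hT : IsCuntzToeplitz2.{u, v} T v₁ v₂)
    (j₀ j₁ : T →⋆ₐ[ℂ] F) (hF : IsFreeProduct.{u, w} T T F j₀ j₁) :
    ∀ t : unitInterval,
      ∃ S : StarSubalgebra ℂ F,
        (S : Set F) = (fun f : C(unitInterval, F) => f t) ''
            {f : C(unitInterval, F) | f 0 ∈ Set.range j₀ ∧ f 1 ∈ Set.range j₁} ∧
        IsClosed (S : Set F) ∧
        ∃ t₁ ∈ S, ∃ t₂ ∈ S,
          star t₁ * t₁ = 1 ∧ star t₂ * t₂ = 1 ∧ t₁ * star t₁ + t₂ * star t₂ ≤ 1 := by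
  obtain ⟨h₁, h₂, hle, -⟩ := hT
  have isometries_map (j : T →⋆ₐ[ℂ] F) : star (j v₁) * j v₁ = 1 ∧ star (j v₂) * j v₂ = 1 ∧
      j v₁ * star (j v₁) + j v₂ * star (j v₂) ≤ 1 := by
    refine ⟨by rw [← map_star, ← map_mul, h₁, map_one],
      by rw [← map_star, ← map_mul, h₂, map_one], ?_⟩
    simpa [map_star] using OrderHomClass.mono j hle
  intro t
  by_cases ht0 : t = 0
  · subst ht0
    refine ⟨j₀.range, ?_, ?_, j₀ v₁, ⟨v₁, rfl⟩, j₀ v₂, ⟨v₂, rfl⟩, isometries_map j₀⟩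
    · ext x
      constructor
      · rintro ⟨a, rfl⟩
        refine ⟨⟨fun s => (1 - (s : ℝ)) • j₀ a, by fun_prop⟩, ⟨⟨a, by simp⟩, ⟨0, by simp⟩⟩, ?_⟩
        simp
      · rintro ⟨f, hf, rfl⟩
        exact hf.1
    · exact j₀.isClosed_range_of_cstarAlgebra
  by_cases ht1 : t = 1
  · subst ht1
    refine ⟨j₁.range, ?_, ?_, j₁ v₁, ⟨v₁, rfl⟩, j₁ v₂, ⟨v₂, rfl⟩, isometries_map j₁⟩
    · ext x
      constructor
      · rintro ⟨a, rfl⟩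
        refine ⟨⟨fun s => (s : ℝ) • j₁ a, by fun_prop⟩, ⟨⟨0, by simp⟩, ⟨a, by simp⟩⟩, ?_⟩
        simp
      · rintro ⟨f, hf, rfl⟩
        exact hf.2
    · exact j₁.isClosed_range_of_cstarAlgebra
  refine ⟨⊤, ?_, isClosed_univ, j₀ v₁, trivial, j₀ v₂, trivial, isometries_map j₀⟩
  refine (Set.eq_univ_of_forall fun x => ?_).symm
  have ht : (t : ℝ) * (1 - t) ≠ 0 :=
    mul_ne_zero (fun h => ht0 (Subtype.ext h))
      (fun h => ht1 (Subtype.ext (by simpa using (sub_eq_zero.mp h).symm)))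
  refine ⟨⟨fun s => ((s : ℝ) * (1 - s) / (t * (1 - t))) • x, by fun_prop⟩,
    ⟨⟨0, by simp⟩, ⟨0, by simp⟩⟩, ?_⟩
  simp [div_self ht]
end
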